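/- Let d ≥ 1, R > 0, η > 0, and let x_1, …, x_{n_in} ∈ ℝ^d satisfy ‖x_i‖₂ ≤ R, where n_in is even with n_in ≥ (2e)^d, and set n_out = n_in/2 and b = 1/2. Let K ∈ ℝ^{n_in×n_in} be the Gaussian kernel matrix K_ij = exp(−η‖x_i − x_j‖₂²). Suppose a thinning algorithm returns a random subset S_out ⊆ S_in = {x_1,…,x_{n_in}} of size n_out and is (K, ν, δ)-sub-Gaussian with ν ≤ √(log(4 n_out/δ))/n_out. Then for any δ' ∈ (0,1), with probability at least 1 − δ/2 − δ', (p_in − q_out)ᵀ K (p_in − q_out) ≤ (1/n_out²)·log(4 n_out/δ)·( e²·max{ ((2e/d)·log(n_in·n_out·b))^d , (4 R² η e³/d)^d } + e·log(1/δ') ) + (1/(n_out·b))·(1/n_out − 1/n_in). -/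

import Mathlib

open MeasureTheory Matrix Finset

noncomputable section

/-- Probability vector of a finite index set: mass `1/|S|` on each element of `S`. -/
def probVec {n : ℕ} (S : Finset (Fin n)) : Fin n → ℝ :=
  fun i => if i ∈ S then ((S.card : ℝ))⁻¹ else 0

theorem abs_exp_sub_sum_le (t : ℝ) (m : ℕ) :
    |Real.exp t - ∑ k ∈ range m, t ^ k / k.factorial| ≤
      |t| ^ m / m.factorial * Real.exp |t| := by
  have h1 : |Real.exp t - ∑ k ∈ range m, t ^ k / k.factorial| ≤
      Real.exp |t| - ∑ k ∈ range m, |t| ^ k / k.factorial := by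
    have h := Complex.norm_exp_sub_sum_le_exp_norm_sub_sum (t : ℂ) m
    rw [Complex.norm_real, Real.norm_eq_abs] at h
    convert h using 1
    rw [← Real.norm_eq_abs, ← Complex.norm_real]
    push_cast
    rfl
  refine h1.trans ?_
  have hs : 0 ≤ |t| := abs_nonneg t
  generalize |t| = s at hs
  have h2 : Filter.Tendsto (fun N => ∑ k ∈ range (m + N), s ^ k / k.factorial)
      Filter.atTop (nhds (Real.exp s)) := by
    have h := (NormedSpace.expSeries_div_hasSum_exp (𝔸 := ℝ) s).tendsto_sum_nat
    rw [← Real.exp_eq_exp_ℝ] at h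
    exact h.comp (Filter.tendsto_add_atTop_iff_nat m |>.2 Filter.tendsto_id |>.congr
      fun N => by simp [add_comm])
  rw [sub_le_iff_le_add']
  refine le_of_tendsto' h2 fun N => ?_
  rw [sum_range_add]
  gcongr
  calc ∑ k ∈ range N, s ^ (m + k) / (m + k).factorial
      ≤ ∑ k ∈ range N, s ^ m / m.factorial * (s ^ k / k.factorial) := by
        refine sum_le_sum fun k _ => ?_
        rw [div_mul_div_comm, ← pow_add]
        gcongr
        exact_mod_cast Nat.le_of_dvd (Nat.factorial_pos _)
          (Nat.factorial_mul_factorial_dvd_factorial_add m k)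
    _ ≤ _ := by
        rw [← mul_sum]
        gcongr
        exact Real.sum_le_exp_of_nonneg hs N

theorem card_sigma_sym (d m : ℕ) :
    Fintype.card (Σ k : Fin (m + 1), Sym (Fin d) k) = (m + d).choose d := by
  rw [Fintype.card_sigma]
  simp only [Sym.card_sym_eq_multichoose, Fintype.card_fin]
  rw [Fin.sum_univ_eq_sum_range (fun k => d.multichoose k), Nat.sum_range_multichoose]

theorem pow_le_exp_mul_factorial (d : ℕ) : (d : ℝ) ^ d ≤ Real.exp 1 ^ d * d.factorial := by
  have := Real.pow_div_factorial_le_exp (x := (d : ℝ)) (by positivity) d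
  rw [div_le_iff₀ (by positivity)] at this
  rwa [← Real.exp_nat_mul, mul_one]

theorem choose_le_pow_of_le {d m : ℕ} (hd : 1 ≤ d) {c : ℝ}
    (h : Real.exp 1 * (m + d) ≤ c * d) : ((m + d).choose d : ℝ) ≤ c ^ d := by
  have hd' : (0 : ℝ) < d := by exact_mod_cast hd
  have hc : Real.exp 1 * (m + d) / d ≤ c := by rwa [div_le_iff₀ hd']
  refine (Nat.choose_le_pow_div (α := ℝ) d (m + d)).trans ?_
  refine le_trans ?_ (pow_le_pow_left₀ (by positivity) hc d)
  rw [div_pow, mul_pow, div_le_div_iff₀ (by positivity) (by positivity)]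
  push_cast
  have := mul_le_mul_of_nonneg_left (pow_le_exp_mul_factorial d)
    (show (0 : ℝ) ≤ (m + d) ^ d by positivity)
  linarith

theorem lintegral_exp_gaussian {ι : Type*} [Fintype ι] {b : ℝ} (hb : 0 < b)
    (z : EuclideanSpace ℝ ι) :
    ∫⁻ g : EuclideanSpace ℝ ι, ENNReal.ofReal (Real.exp (-b * ‖g‖ ^ 2 + inner ℝ g z)) =
      ENNReal.ofReal ((Real.pi / b) ^ (Fintype.card ι / 2 : ℝ) *
        Real.exp (‖z‖ ^ 2 / (4 * b))) := by
  have hI := GaussianFourier.integrable_cexp_neg_mul_sq_norm_add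
    (b := (b : ℂ)) (by simpa using hb) 1 z
  have hval := GaussianFourier.integral_cexp_neg_mul_sq_norm_add
    (b := (b : ℂ)) (by simpa using hb) 1 z
  have heq : ∀ v : EuclideanSpace ℝ ι,
      Complex.exp (-(b : ℂ) * (‖v‖ : ℂ) ^ 2 + 1 * (inner ℝ z v : ℝ)) =
        ((Real.exp (-b * ‖v‖ ^ 2 + inner ℝ v z) : ℝ) : ℂ) := by
    intro v
    rw [real_inner_comm]
    push_cast
    simp
  simp only [heq] at hI hval
  have hI' : Integrable fun v : EuclideanSpace ℝ ι =>
      Real.exp (-b * ‖v‖ ^ 2 + inner ℝ v z) := by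
    refine hI.re.congr (.of_forall fun v => ?_)
    exact Complex.ofReal_re _
  rw [← ofReal_integral_eq_lintegral_ofReal hI' (.of_forall fun _ => (Real.exp_pos _).le)]
  congr 1
  rw [integral_complex_ofReal] at hval
  rw [← Complex.ofReal_inj, hval]
  push_cast [Complex.ofReal_cpow (show 0 ≤ Real.pi / b by positivity)]
  simp

theorem exp_one_div_le : Real.exp 1 / (Real.exp 1 - 2) ≤ Real.exp 1 ^ 2 := by
  have h := Real.exp_one_gt_d9
  rw [div_le_iff₀ (by linarith)]
  nlinarith

theorem subGaussian_norm_sq_tail {Ω ι : Type*} [MeasurableSpace Ω] [Fintype ι]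
    (μ : Measure Ω) [IsFiniteMeasure μ] {z : Ω → EuclideanSpace ℝ ι} (hz : Measurable z)
    {ν : ℝ} (hν : 0 < ν)
    (h : ∀ g, ∫⁻ ω, ENNReal.ofReal (Real.exp (inner ℝ g (z ω))) ∂μ ≤
      ENNReal.ofReal (Real.exp (ν ^ 2 / 2 * ‖g‖ ^ 2)))
    {δ : ℝ} (hδ : 0 < δ) :
    μ {ω | ν ^ 2 * (Real.exp 1 ^ 2 * Fintype.card ι + Real.exp 1 * Real.log (1 / δ)) ≤
      ‖z ω‖ ^ 2} ≤ ENNReal.ofReal δ := by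
  have he := Real.exp_one_gt_d9
  set r := Fintype.card ι with hr
  set b : ℝ := Real.exp 1 * ν ^ 2 / 4 with hbdef
  set c : ℝ := b - ν ^ 2 / 2 with hcdef
  have hν2 : 0 < ν ^ 2 := by positivity
  have hb : 0 < b := by positivity
  have hc : 0 < c := by rw [hcdef, hbdef]; nlinarith
  have key : ∫⁻ ω, ENNReal.ofReal ((Real.pi / b) ^ (r / 2 : ℝ) *
      Real.exp (‖z ω‖ ^ 2 / (4 * b))) ∂μ ≤ ENNReal.ofReal ((Real.pi / c) ^ (r / 2 : ℝ)) := by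
    simp_rw [hr, ← lintegral_exp_gaussian hb]
    rw [lintegral_lintegral_swap (by fun_prop)]
    have h0 := lintegral_exp_gaussian hc (0 : EuclideanSpace ℝ ι)
    simp only [inner_zero_right, add_zero, norm_zero] at h0
    norm_num at h0
    rw [← h0]
    refine lintegral_mono fun g => ?_
    simp_rw [Real.exp_add, ENNReal.ofReal_mul (Real.exp_pos _).le]
    rw [lintegral_const_mul _ (by fun_prop)]
    refine (mul_le_mul_right (h g) _).trans_eq ?_
    rw [← ENNReal.ofReal_mul (Real.exp_pos _).le, ← Real.exp_add]
    congr 2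
    rw [hcdef]; ring
  set τ := ν ^ 2 * (Real.exp 1 ^ 2 * r + Real.exp 1 * Real.log (1 / δ)) with hτ
  have hP : 0 < (Real.pi / b) ^ (r / 2 : ℝ) := by positivity
  have hM := mul_meas_ge_le_lintegral₀ (μ := μ) (f := fun ω =>
    ENNReal.ofReal ((Real.pi / b) ^ (r / 2 : ℝ) * Real.exp (‖z ω‖ ^ 2 / (4 * b))))
    (by fun_prop) (ENNReal.ofReal ((Real.pi / b) ^ (r / 2 : ℝ) * Real.exp (τ / (4 * b))))
  have hset : {ω | τ ≤ ‖z ω‖ ^ 2} ⊆ {ω |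
      ENNReal.ofReal ((Real.pi / b) ^ (r / 2 : ℝ) * Real.exp (τ / (4 * b))) ≤
      ENNReal.ofReal ((Real.pi / b) ^ (r / 2 : ℝ) * Real.exp (‖z ω‖ ^ 2 / (4 * b)))} := by
    intro ω hω
    simp only [Set.mem_ofPred_eq] at hω ⊢
    gcongr
  have hle : (Real.pi / c) ^ (r / 2 : ℝ) ≤
      (Real.pi / b) ^ (r / 2 : ℝ) * Real.exp (τ / (4 * b)) * δ := by
    have hexp : Real.exp (τ / (4 * b)) * δ = Real.exp (Real.exp 1 * r) := by
      have : τ / (4 * b) = Real.exp 1 * r + Real.log (1 / δ) := by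
        rw [hτ, hbdef]; field_simp
      rw [this, Real.exp_add, Real.exp_log (by positivity)]
      field_simp
    rw [mul_assoc, hexp]
    have hratio : Real.pi / c = Real.pi / b * (Real.exp 1 / (Real.exp 1 - 2)) := by
      have : Real.exp 1 - 2 ≠ 0 := by linarith
      have hc' : c = ν ^ 2 / 4 * (Real.exp 1 - 2) := by rw [hcdef, hbdef]; ring
      rw [hc', hbdef]; field_simp
    have hq : 0 ≤ Real.exp 1 / (Real.exp 1 - 2) := div_nonneg (by linarith) (by linarith)
    rw [hratio, Real.mul_rpow (by positivity) hq]
    gcongr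
    calc (Real.exp 1 / (Real.exp 1 - 2)) ^ (r / 2 : ℝ)
        ≤ (Real.exp 1 ^ 2) ^ (r / 2 : ℝ) :=
          Real.rpow_le_rpow hq exp_one_div_le (by positivity)
      _ = Real.exp r := by
          rw [← Real.exp_nat_mul, ← Real.exp_mul]; congr 1; push_cast; ring
      _ ≤ _ := by
          gcongr
          nlinarith [(Nat.cast_nonneg r : (0 : ℝ) ≤ r)]
  have hfin := (mul_le_mul_right (measure_mono hset) _).trans
    (hM.trans (key.trans (ENNReal.ofReal_le_ofReal hle)))
  rw [ENNReal.ofReal_mul (q := δ) (by positivity)] at hfin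
  exact (ENNReal.mul_le_mul_iff_right (by simpa using by positivity) ENNReal.ofReal_ne_top).1 hfin

theorem Matrix.IsHermitian.dotProduct_mulVec_eq_sum {n : ℕ} {K : Matrix (Fin n) (Fin n) ℝ}
    (hK : K.IsHermitian) (u w : Fin n → ℝ) :
    u ⬝ᵥ (K *ᵥ w) = ∑ i, hK.eigenvalues i * (hK.eigenvectorBasis i ⬝ᵥ u) *
      (hK.eigenvectorBasis i ⬝ᵥ w) := by
  have h := hK.eigenvectorBasis.sum_inner_mul_inner (WithLp.toLp 2 u) (WithLp.toLp 2 (K *ᵥ w))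
  simp only [EuclideanSpace.inner_eq_star_dotProduct, star_trivial] at h
  rw [dotProduct_comm, ← h]
  refine sum_congr rfl fun i _ => ?_
  have hKw : (K *ᵥ w) ⬝ᵥ (hK.eigenvectorBasis i).ofLp =
      hK.eigenvalues i * (hK.eigenvectorBasis i ⬝ᵥ w) := by
    have hT : Kᵀ = K := by simpa using hK.eq
    rw [dotProduct_comm, dotProduct_mulVec, ← mulVec_transpose, hT,
      hK.mulVec_eigenvectorBasis, smul_dotProduct, smul_eq_mul]
  rw [hKw]
  ring

theorem Matrix.IsHermitian.sum_eigenvectorBasis_dotProduct_sq {n : ℕ}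
    {K : Matrix (Fin n) (Fin n) ℝ} (hK : K.IsHermitian) (w : Fin n → ℝ) :
    ∑ i, (hK.eigenvectorBasis i ⬝ᵥ w) ^ 2 = w ⬝ᵥ w := by
  have h := hK.eigenvectorBasis.sum_inner_mul_inner (WithLp.toLp 2 w) (WithLp.toLp 2 w)
  simp only [EuclideanSpace.inner_eq_star_dotProduct, star_trivial] at h
  rw [← h]
  refine sum_congr rfl fun i _ => ?_
  rw [dotProduct_comm w]; ring

theorem Matrix.IsHermitian.eigenvectorBasis_dotProduct {n : ℕ}
    {K : Matrix (Fin n) (Fin n) ℝ} (hK : K.IsHermitian) (i j : Fin n) :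
    hK.eigenvectorBasis i ⬝ᵥ hK.eigenvectorBasis j = if i = j then (1 : ℝ) else 0 := by
  have h := orthonormal_iff_ite.1 hK.eigenvectorBasis.orthonormal i j
  rw [EuclideanSpace.inner_eq_star_dotProduct, star_trivial, dotProduct_comm] at h
  exact h

/-- The vector `∑ a i • v i` over a set of eigenvectors `v i`. -/
def eigenComb {n : ℕ} {K : Matrix (Fin n) (Fin n) ℝ} (hK : K.IsHermitian) (p : Fin n → Prop)
    [DecidablePred p] : ({i // p i} → ℝ) →ₗ[ℝ] (Fin n → ℝ) where
  toFun a := ∑ i, a i • (hK.eigenvectorBasis i : Fin n → ℝ)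
  map_add' a b := by simp [add_smul, sum_add_distrib]
  map_smul' c a := by simp [smul_sum, smul_smul]

theorem eigenvectorBasis_dotProduct_eigenComb {n : ℕ} {K : Matrix (Fin n) (Fin n) ℝ}
    (hK : K.IsHermitian) (p : Fin n → Prop) [DecidablePred p] (a : {i // p i} → ℝ) (j : Fin n) :
    hK.eigenvectorBasis j ⬝ᵥ eigenComb hK p a = if h : p j then a ⟨j, h⟩ else 0 := by
  simp only [eigenComb, LinearMap.coe_mk, AddHom.coe_mk, dotProduct_sum, dotProduct_smul,
    hK.eigenvectorBasis_dotProduct, smul_eq_mul]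
  split_ifs with h
  · rw [Finset.sum_eq_single ⟨j, h⟩]
    · simp
    · rintro i - hi
      rw [if_neg fun hj => hi (Subtype.ext hj.symm), mul_zero]
    · simp
  · refine sum_eq_zero fun i _ => ?_
    rw [if_neg fun hj : j = i => h (hj ▸ i.2), mul_zero]

theorem sum_dite_subtype {n : ℕ} (p : Fin n → Prop) [DecidablePred p] (f : {i // p i} → ℝ) :
    ∑ j, (if h : p j then f ⟨j, h⟩ else 0) = ∑ i, f i := by
  rw [← Fintype.sum_subtype_add_sum_subtype p]
  rw [Fintype.sum_eq_zero (fun i : {x // ¬ p x} => _) (fun i => dif_neg i.2), add_zero]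
  exact Fintype.sum_congr _ _ fun i => dif_pos i.2

/-- If the quadratic form of `K` is at most `c‖v‖²` on the kernel of a linear map, then at most as
many eigenvalues as the dimension of the target exceed `c`. -/
theorem card_eigenvalues_gt_le {n : ℕ} {K : Matrix (Fin n) (Fin n) ℝ} (hK : K.IsHermitian)
    {κ : Type*} [Fintype κ] (F : (Fin n → ℝ) →ₗ[ℝ] (κ → ℝ)) (c : ℝ)
    (h : ∀ v, F v = 0 → v ⬝ᵥ (K *ᵥ v) ≤ c * (v ⬝ᵥ v)) :
    Fintype.card {i // c < hK.eigenvalues i} ≤ Fintype.card κ := by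
  have hinj : Function.Injective (F ∘ₗ eigenComb hK (fun i => c < hK.eigenvalues i)) := by
    rw [← LinearMap.ker_eq_bot, LinearMap.ker_eq_bot']
    intro a ha
    have hv := h _ ha
    rw [hK.dotProduct_mulVec_eq_sum, ← hK.sum_eigenvectorBasis_dotProduct_sq, mul_sum,
      ← sub_nonneg, ← sum_sub_distrib] at hv
    simp only [eigenvectorBasis_dotProduct_eigenComb] at hv
    have hnonneg : ∀ i ∈ (univ : Finset {i // c < hK.eigenvalues i}),
        0 ≤ (hK.eigenvalues i - c) * a i ^ 2 := fun i _ =>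
      mul_nonneg (sub_nonneg.2 i.2.le) (sq_nonneg _)
    have hsum : ∑ i : {i // c < hK.eigenvalues i}, (hK.eigenvalues i - c) * a i ^ 2 ≤ 0 := by
      rw [← sum_dite_subtype (fun i => c < hK.eigenvalues i)
        (fun i => (hK.eigenvalues i - c) * a i ^ 2), ← neg_nonneg, ← sum_neg_distrib]
      refine hv.trans_eq (sum_congr rfl fun j _ => ?_)
      split_ifs <;> ring
    have h0 := (sum_eq_zero_iff_of_nonneg hnonneg).1 (le_antisymm hsum (sum_nonneg hnonneg))
    funext i
    have := h0 i (mem_univ i)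
    simpa [(sub_pos.2 i.2).ne'] using this
  simpa using LinearMap.finrank_le_finrank_of_injective hinj

/-- Weighted moments of a vector against all monomials of degree less than `m`. -/
def monomialMoments {d n : ℕ} (m : ℕ) (a : Fin n → ℝ) (x : Fin n → EuclideanSpace ℝ (Fin d)) :
    (Fin n → ℝ) →ₗ[ℝ] ((Σ k : Fin m, Sym (Fin d) k) → ℝ) where
  toFun v s := ∑ i, v i * a i * (s.2.1.map (x i)).prod
  map_add' v w := by
    funext s
    simp [add_mul, sum_add_distrib]
  map_smul' c v := by
    funext s
    simp [mul_sum, mul_assoc]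

theorem sum_inner_pow_eq_zero {d n m : ℕ} {a : Fin n → ℝ} {x : Fin n → EuclideanSpace ℝ (Fin d)}
    {v : Fin n → ℝ} (hv : monomialMoments m a x v = 0) {k : ℕ} (hk : k < m) :
    ∑ i, ∑ j, (v i * a i) * (v j * a j) * inner ℝ (x i) (x j) ^ k = 0 := by
  have hmom : ∀ s : Sym (Fin d) k, ∑ i, v i * a i * (s.1.map (x i)).prod = 0 := fun s =>
    congrFun hv ⟨⟨k, hk⟩, s⟩
  have hpow : ∀ i j, inner ℝ (x i) (x j) ^ k =
      ∑ s ∈ (univ : Finset (Fin d)).sym k, (s.1.countPerms : ℝ) *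
        ((s.1.map (x i)).prod * (s.1.map (x j)).prod) := by
    intro i j
    rw [PiLp.inner_apply, Finset.sum_pow]
    refine sum_congr rfl fun s _ => ?_
    rw [← Multiset.prod_map_mul]
    simp [mul_comm]
  calc ∑ i, ∑ j, (v i * a i) * (v j * a j) * inner ℝ (x i) (x j) ^ k
      = ∑ s ∈ (univ : Finset (Fin d)).sym k, (s.1.countPerms : ℝ) *
          ((∑ i, v i * a i * (s.1.map (x i)).prod) *
            ∑ j, v j * a j * (s.1.map (x j)).prod) := by
        simp_rw [hpow, sum_mul_sum, mul_sum]
        rw [eq_comm, sum_comm]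
        refine sum_congr rfl fun i _ => ?_
        rw [sum_comm]
        refine sum_congr rfl fun j _ => sum_congr rfl fun k _ => ?_
        ring
    _ = 0 := sum_eq_zero fun s _ => by rw [hmom s, zero_mul, mul_zero]

theorem gaussian_form_le {d n m : ℕ} {R η : ℝ} (hη : 0 < η)
    {x : Fin n → EuclideanSpace ℝ (Fin d)} (hx : ∀ i, ‖x i‖ ≤ R)
    {K : Matrix (Fin n) (Fin n) ℝ} (hK : ∀ i j, K i j = Real.exp (-η * ‖x i - x j‖ ^ 2))
    {v : Fin n → ℝ} (hv : monomialMoments m (fun i => Real.exp (-η * ‖x i‖ ^ 2)) x v = 0) :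
    v ⬝ᵥ (K *ᵥ v) ≤ n * ((2 * η * R ^ 2) ^ m / m.factorial) * (v ⬝ᵥ v) := by
  set a : Fin n → ℝ := fun i => Real.exp (-η * ‖x i‖ ^ 2) with ha
  set ε : ℝ := (2 * η * R ^ 2) ^ m / m.factorial with hε
  have hKij : ∀ i j, K i j = a i * a j * Real.exp (2 * η * inner ℝ (x i) (x j)) := by
    intro i j
    rw [hK, ha, ← Real.exp_add, ← Real.exp_add, norm_sub_sq_real]
    ring_nf
  have hrem : ∀ i j, |a i * a j * (Real.exp (2 * η * inner ℝ (x i) (x j)) -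
      ∑ k ∈ range m, (2 * η * inner ℝ (x i) (x j)) ^ k / k.factorial)| ≤ ε := by
    intro i j
    have hin := abs_real_inner_le_norm (x i) (x j)
    have hxi := hx i
    have hxj := hx j
    have hni := norm_nonneg (x i)
    have hnj := norm_nonneg (x j)
    have haa : 0 < a i * a j := mul_pos (Real.exp_pos _) (Real.exp_pos _)
    have habs : |2 * η * inner ℝ (x i) (x j)| = 2 * η * |inner ℝ (x i) (x j)| := by
      rw [abs_mul, abs_of_pos (by positivity : 0 < 2 * η)]
    have h1 : |2 * η * inner ℝ (x i) (x j)| ≤ 2 * η * R ^ 2 := by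
      rw [habs]
      gcongr
      nlinarith
    have h2 : a i * a j * Real.exp |2 * η * inner ℝ (x i) (x j)| ≤ 1 := by
      rw [ha, ← Real.exp_add, ← Real.exp_add, Real.exp_le_one_iff, habs]
      nlinarith [mul_le_mul_of_nonneg_left hin hη.le, mul_nonneg hη.le (sq_nonneg (‖x i‖ - ‖x j‖))]
    rw [abs_mul, abs_of_pos haa]
    calc _ ≤ a i * a j * (|2 * η * inner ℝ (x i) (x j)| ^ m / m.factorial *
          Real.exp |2 * η * inner ℝ (x i) (x j)|) := by
          gcongr
          exact abs_exp_sub_sum_le _ _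
      _ = |2 * η * inner ℝ (x i) (x j)| ^ m / m.factorial *
          (a i * a j * Real.exp |2 * η * inner ℝ (x i) (x j)|) := by ring
      _ ≤ ε * 1 := by
          rw [hε]
          gcongr
      _ = ε := mul_one ε
  have hε0 : 0 ≤ ε := by positivity
  have hlow : ∑ i, ∑ j, v i * v j * (a i * a j *
      ∑ k ∈ range m, (2 * η * inner ℝ (x i) (x j)) ^ k / k.factorial) = 0 := by
    calc _ = ∑ k ∈ range m, (2 * η) ^ k / k.factorial *
          ∑ i, ∑ j, (v i * a i) * (v j * a j) * inner ℝ (x i) (x j) ^ k := by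
          simp_rw [mul_sum]
          rw [eq_comm, sum_comm]
          refine sum_congr rfl fun i _ => ?_
          rw [sum_comm]
          refine sum_congr rfl fun j _ => sum_congr rfl fun k _ => ?_
          rw [mul_pow]
          ring
      _ = 0 := sum_eq_zero fun k hk => by
          rw [sum_inner_pow_eq_zero hv (mem_range.1 hk), mul_zero]
  calc v ⬝ᵥ (K *ᵥ v)
      = ∑ i, ∑ j, v i * v j * (a i * a j * (Real.exp (2 * η * inner ℝ (x i) (x j)) -
          ∑ k ∈ range m, (2 * η * inner ℝ (x i) (x j)) ^ k / k.factorial)) := by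
        rw [← sub_zero (v ⬝ᵥ _), ← hlow]
        simp only [dotProduct, mulVec, mul_sum (s := univ), ← sum_sub_distrib, hKij]
        refine sum_congr rfl fun i _ => sum_congr rfl fun j _ => ?_
        ring
    _ ≤ ∑ i, ∑ j, |v i| * |v j| * ε := by
        refine sum_le_sum fun i _ => sum_le_sum fun j _ => (le_abs_self _).trans ?_
        rw [abs_mul, abs_mul]
        gcongr
        exact hrem i j
    _ = ε * (∑ i, |v i|) ^ 2 := by
        rw [sq, sum_mul_sum, mul_sum]
        refine sum_congr rfl fun i _ => ?_
        rw [mul_sum]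
        exact sum_congr rfl fun j _ => by ring
    _ ≤ ε * (n * ∑ i, |v i| ^ 2) := by
        gcongr
        simpa using sq_sum_le_card_mul_sum_sq (s := univ) (f := fun i => |v i|)
    _ = _ := by
        simp only [sq_abs, dotProduct, ← sq]
        ring

theorem exists_degree {d : ℕ} (hd : 1 ≤ d) {R η L μ : ℝ} (hη : 0 < η)
    (hL : 2 * Real.exp 1 / d * L ≤ μ) (hμR : 4 * R ^ 2 * η * Real.exp 1 ^ 3 / d ≤ μ)
    (hμ : 2 * Real.exp 1 ≤ μ) :
    ∃ m : ℕ, (((m + d).choose d : ℕ) : ℝ) ≤ μ ^ d ∧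
      (2 * η * R ^ 2) ^ (m + 1) / (m + 1).factorial ≤ Real.exp (-L) := by
  have hd' : (0 : ℝ) < d := by exact_mod_cast hd
  have he := Real.exp_pos 1
  set e := Real.exp 1 with hedef
  have hpos : 0 < μ * d / (2 * e) := by
    have : 0 < μ := by linarith
    positivity
  obtain ⟨m, hm⟩ : ∃ m, ⌈μ * d / (2 * e)⌉₊ = m + 1 :=
    Nat.exists_eq_succ_of_ne_zero (Nat.ceil_pos.2 hpos).ne'
  have hlt : (m : ℝ) < μ * d / (2 * e) := Nat.lt_ceil.1 (by omega)
  have hle : μ * d / (2 * e) ≤ (m + 1 : ℕ) := by rw [← hm]; exact Nat.le_ceil _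
  refine ⟨m, choose_le_pow_of_le hd ?_, ?_⟩
  · rw [lt_div_iff₀ (by positivity)] at hlt
    nlinarith
  · have h1 : 2 * η * R ^ 2 * e ^ 2 ≤ (m + 1 : ℕ) := by
      refine le_trans ?_ hle
      rw [div_le_iff₀ hd'] at hμR
      rw [le_div_iff₀ (by positivity)]
      linarith
    have h2 : L ≤ (m + 1 : ℕ) := by
      refine le_trans ?_ hle
      rw [div_mul_eq_mul_div, div_le_iff₀ hd'] at hL
      rw [le_div_iff₀ (by positivity)]
      linarith
    refine le_trans ?_ (Real.exp_le_exp.2 (neg_le_neg h2))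
    have hfac := pow_le_exp_mul_factorial (m + 1)
    have h3 := (pow_le_pow_left₀ (by positivity) h1 (m + 1)).trans hfac
    have hexp : Real.exp (-((m + 1 : ℕ) : ℝ)) = (e ^ (m + 1))⁻¹ := by
      rw [Real.exp_neg, hedef, ← Real.exp_nat_mul, mul_one]
    rw [hexp, div_le_iff₀ (by positivity), inv_mul_eq_div, le_div_iff₀ (by positivity)]
    refine le_of_mul_le_mul_left ?_ (show 0 < e ^ (m + 1) by positivity)
    calc e ^ (m + 1) * ((2 * η * R ^ 2) ^ (m + 1) * e ^ (m + 1))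
        = (2 * η * R ^ 2 * e ^ 2) ^ (m + 1) := by
          rw [mul_pow _ (e ^ 2), ← pow_mul, mul_comm 2, pow_mul]; ring
      _ ≤ _ := h3

theorem two_mul_le_log {d n : ℕ} (hd : 1 ≤ d) (hn : (2 * Real.exp 1) ^ d ≤ (n : ℝ)) :
    2 * (d : ℝ) ≤ Real.log ((n : ℝ) ^ 2 / 4) := by
  have h2 : (2 : ℝ) ≤ 2 ^ d := le_self_pow₀ (by norm_num) (by omega)
  have h1 : 2 * Real.exp d ≤ n := by
    refine le_trans ?_ hn
    rw [mul_pow, ← Real.exp_nat_mul, mul_one]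
    gcongr
  have hpos : (0 : ℝ) < n := lt_of_lt_of_le (by positivity) h1
  rw [Real.le_log_iff_exp_le (by positivity), le_div_iff₀ (by norm_num)]
  calc Real.exp (2 * d) * 4 = (2 * Real.exp d) ^ 2 := by
        rw [mul_pow, ← Real.exp_nat_mul]; push_cast; ring
    _ ≤ _ := by gcongr

theorem card_gaussian_eigenvalues_le {d n : ℕ} (hd : 1 ≤ d) {R η : ℝ} (hη : 0 < η)
    {x : Fin n → EuclideanSpace ℝ (Fin d)} (hx : ∀ i, ‖x i‖ ≤ R)
    (hbig : (2 * Real.exp 1) ^ d ≤ (n : ℝ))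
    {K : Matrix (Fin n) (Fin n) ℝ} (hK : K.IsHermitian)
    (hKdef : ∀ i j, K i j = Real.exp (-η * ‖x i - x j‖ ^ 2)) :
    (Fintype.card {i // 4 / (n : ℝ) < hK.eigenvalues i} : ℝ) ≤
      max ((2 * Real.exp 1 / d * Real.log ((n : ℝ) ^ 2 / 4)) ^ d)
        ((4 * R ^ 2 * η * Real.exp 1 ^ 3 / d) ^ d) := by
  have hd' : (0 : ℝ) < d := by exact_mod_cast hd
  have hn : (0 : ℝ) < n := lt_of_lt_of_le (by positivity) hbig
  set L := Real.log ((n : ℝ) ^ 2 / 4) with hLdef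
  have hL : 2 * (d : ℝ) ≤ L := two_mul_le_log hd hbig
  have hμ : 2 * Real.exp 1 ≤
      max (2 * Real.exp 1 / d * L) (4 * R ^ 2 * η * Real.exp 1 ^ 3 / d) := by
    refine le_max_of_le_left ?_
    rw [div_mul_eq_mul_div, le_div_iff₀ hd']
    gcongr
    linarith
  obtain ⟨m, hcard, hε⟩ := exists_degree hd hη (le_max_left (2 * Real.exp 1 / d * L)
    (4 * R ^ 2 * η * Real.exp 1 ^ 3 / d)) (le_max_right _ _) hμ
  have hle := card_eigenvalues_gt_le hK
    (monomialMoments (m + 1) (fun i => Real.exp (-η * ‖x i‖ ^ 2)) x) (4 / (n : ℝ)) (by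
      intro v hv
      refine (gaussian_form_le hη hx hKdef hv).trans ?_
      have hvv : 0 ≤ v ⬝ᵥ v := sum_nonneg fun i _ => mul_self_nonneg (v i)
      refine mul_le_mul_of_nonneg_right ?_ hvv
      calc _ ≤ n * Real.exp (-L) := by gcongr
        _ = 4 / n := by
          rw [Real.exp_neg, hLdef, Real.exp_log (by positivity)]
          field_simp)
  rw [card_sigma_sym] at hle
  refine (Nat.cast_le.2 hle).trans (hcard.trans ?_)
  rcases max_choice (2 * Real.exp 1 / d * L) (4 * R ^ 2 * η * Real.exp 1 ^ 3 / d) with h | h <;>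
    rw [h]
  exacts [le_max_left _ _, le_max_right _ _]

theorem probVec_sub_dotProduct_self {n : ℕ} {S : Finset (Fin n)} (hS : 0 < S.card) :
    (probVec univ - probVec S) ⬝ᵥ (probVec univ - probVec S) = 1 / (S.card : ℝ) - 1 / n := by
  have hS' : (0 : ℝ) < S.card := by exact_mod_cast hS
  have hn : (0 : ℝ) < n := by
    have := hS.trans_le (card_le_univ S)
    rw [Fintype.card_fin] at this
    exact_mod_cast this
  have hterm : ∀ i, (probVec univ i - probVec S i) * (probVec univ i - probVec S i) =
      (n : ℝ)⁻¹ ^ 2 +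
        if i ∈ S then ((S.card : ℝ)⁻¹ ^ 2 - 2 * (n : ℝ)⁻¹ * (S.card : ℝ)⁻¹) else 0 := by
    intro i
    simp only [probVec, mem_univ, if_true, card_univ, Fintype.card_fin]
    split_ifs <;> ring
  simp only [dotProduct, Pi.sub_apply, hterm, sum_add_distrib, sum_ite_mem, univ_inter, sum_const,
    card_univ, Fintype.card_fin, nsmul_eq_mul]
  field_simp
  ring

theorem dotProduct_mulVec_le {n : ℕ} {K : Matrix (Fin n) (Fin n) ℝ} (hK : K.IsHermitian)
    {c : ℝ} (hc : 0 ≤ c) (w : Fin n → ℝ) :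
    w ⬝ᵥ (K *ᵥ w) ≤ ∑ i : {i // c < hK.eigenvalues i},
      hK.eigenvalues i * (hK.eigenvectorBasis i ⬝ᵥ w) ^ 2 + c * (w ⬝ᵥ w) := by
  rw [hK.dotProduct_mulVec_eq_sum, ← hK.sum_eigenvectorBasis_dotProduct_sq,
    ← sum_dite_subtype (fun i => c < hK.eigenvalues i)
      (fun i => hK.eigenvalues i * (hK.eigenvectorBasis i ⬝ᵥ w) ^ 2), mul_sum, ← sum_add_distrib]
  refine sum_le_sum fun i _ => ?_
  have hsq := sq_nonneg (hK.eigenvectorBasis i ⬝ᵥ w)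
  split_ifs with h
  · nlinarith [mul_nonneg hc hsq]
  · nlinarith [mul_le_mul_of_nonneg_right (not_lt.1 h) hsq]

/-- Coordinates of `w` on the eigenvectors with eigenvalue above `c`, scaled by the square roots of
the eigenvalues. -/
def eigenCoords {n : ℕ} {K : Matrix (Fin n) (Fin n) ℝ} (hK : K.IsHermitian) (c : ℝ)
    (w : Fin n → ℝ) : EuclideanSpace ℝ {i // c < hK.eigenvalues i} :=
  WithLp.toLp 2 fun i => √(hK.eigenvalues i) * (hK.eigenvectorBasis i ⬝ᵥ w)

theorem measurable_eigenCoords {n : ℕ} {K : Matrix (Fin n) (Fin n) ℝ} (hK : K.IsHermitian)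
    (c : ℝ) : Measurable (eigenCoords hK c) := by
  unfold eigenCoords dotProduct
  fun_prop

theorem norm_eigenCoords_sq {n : ℕ} {K : Matrix (Fin n) (Fin n) ℝ} (hK : K.IsHermitian)
    {c : ℝ} (hc : 0 ≤ c) (w : Fin n → ℝ) :
    ‖eigenCoords hK c w‖ ^ 2 = ∑ i : {i // c < hK.eigenvalues i},
      hK.eigenvalues i * (hK.eigenvectorBasis i ⬝ᵥ w) ^ 2 := by
  rw [EuclideanSpace.norm_sq_eq]
  refine sum_congr rfl fun i _ => ?_
  rw [eigenCoords, Real.norm_eq_abs, sq_abs, mul_pow, Real.sq_sqrt (hc.trans i.2.le)]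

theorem exists_dual_eigenCoords {n : ℕ} {K : Matrix (Fin n) (Fin n) ℝ} (hK : K.IsHermitian)
    {c : ℝ} (hc : 0 ≤ c) (g : EuclideanSpace ℝ {i // c < hK.eigenvalues i}) :
    ∃ u : Fin n → ℝ, u ⬝ᵥ (K *ᵥ u) = ‖g‖ ^ 2 ∧
      ∀ w, u ⬝ᵥ (K *ᵥ w) = inner ℝ g (eigenCoords hK c w) := by
  refine ⟨eigenComb hK _ fun i => g i / √(hK.eigenvalues i), ?_, fun w => ?_⟩
  · rw [hK.dotProduct_mulVec_eq_sum, EuclideanSpace.norm_sq_eq,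
      ← sum_dite_subtype (fun i => c < hK.eigenvalues i)]
    refine sum_congr rfl fun i _ => ?_
    rw [eigenvectorBasis_dotProduct_eigenComb]
    split_ifs with h
    · have hpos := hc.trans_lt h
      have hs := Real.sqrt_pos.2 hpos
      rw [Real.norm_eq_abs, sq_abs]
      nth_rewrite 1 [← Real.sq_sqrt hpos.le]
      field_simp
    · ring
  · rw [hK.dotProduct_mulVec_eq_sum, PiLp.inner_apply,
      ← sum_dite_subtype (fun i => c < hK.eigenvalues i)]
    refine sum_congr rfl fun i _ => ?_
    rw [eigenvectorBasis_dotProduct_eigenComb]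
    split_ifs with h
    · have hpos := hc.trans_lt h
      have hs := Real.sqrt_pos.2 hpos
      nth_rewrite 1 [← Real.sq_sqrt hpos.le]
      simp only [eigenCoords, RCLike.inner_apply, conj_trivial]
      field_simp
    · ring

theorem stmt5 {d nin nout : ℕ} {Ω : Type*} [MeasureSpace Ω]
    [IsProbabilityMeasure (volume : Measure Ω)]
    (hd : 1 ≤ d) (R η : ℝ) (hR : 0 < R) (hη : 0 < η)
    (x : Fin nin → EuclideanSpace ℝ (Fin d)) (hx : ∀ i, ‖x i‖ ≤ R)
    (hnout : 2 * nout = nin)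
    (hbig : (2 * Real.exp 1) ^ d ≤ (nin : ℝ))
    (b : ℝ) (hb : b = 1/2)
    (K : Matrix (Fin nin) (Fin nin) ℝ)
    (hKdef : ∀ i j, K i j = Real.exp (-η * ‖x i - x j‖^2))
    (Sout : Ω → Finset (Fin nin)) (hcard : ∀ ω, (Sout ω).card = nout)
    (w : Ω → Fin nin → ℝ)
    (hw : ∀ ω, w ω = probVec (Finset.univ) - probVec (Sout ω))
    (hmeasw : Measurable w)
    (ν : ℝ) (hν : 0 < ν) (δ : ℝ) (hδ : δ ∈ Set.Ico (0:ℝ) 1)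
    (hνbound : ν ≤ Real.sqrt (Real.log (4 * (nout : ℝ) / δ)) / (nout : ℝ))
    (E : Set Ω) (hE : MeasurableSet E) (hPE : 1 - δ/2 ≤ (volume E).toReal)
    (hsubg : ∀ u : Fin nin → ℝ,
      (∫ ω in E, Real.exp (u ⬝ᵥ (K *ᵥ w ω))) ≤ Real.exp (ν^2/2 * (u ⬝ᵥ (K *ᵥ u))))
    (δ' : ℝ) (hδ' : δ' ∈ Set.Ioo (0:ℝ) 1) :
    1 - δ/2 - δ' ≤ (volume {ω | w ω ⬝ᵥ (K *ᵥ w ω) ≤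
      (1/(nout : ℝ)^2) * Real.log (4 * (nout : ℝ) / δ) *
        (Real.exp 1 ^ 2 *
          max (((2 * Real.exp 1 / (d : ℝ)) * Real.log ((nin : ℝ) * (nout : ℝ) * b)) ^ d)
              ((4 * R^2 * η * Real.exp 1 ^ 3 / (d : ℝ)) ^ d)
         + Real.exp 1 * Real.log (1/δ'))
      + (1/((nout : ℝ) * b)) * (1/(nout : ℝ) - 1/(nin : ℝ))}).toReal := by
  have hin : (0 : ℝ) < nin := lt_of_lt_of_le (by positivity) hbig
  have hnn : (nin : ℝ) = 2 * nout := by exact_mod_cast hnout.symm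
  have hout : (0 : ℝ) < nout := by linarith
  have hK : K.IsHermitian := by
    ext i j
    simp [hKdef, norm_sub_rev]
  set c : ℝ := 4 / (nin : ℝ) with hcdef
  have hc : 0 ≤ c := by positivity
  set lg := Real.log (4 * (nout : ℝ) / δ)
  have hνsq : ν ^ 2 ≤ 1 / (nout : ℝ) ^ 2 * lg := by
    have hs : 0 < √lg := by
      by_contra! hs
      have := div_nonpos_of_nonpos_of_nonneg hs hout.le
      linarith
    calc ν ^ 2 ≤ (√lg / nout) ^ 2 := by gcongr
      _ = 1 / (nout : ℝ) ^ 2 * lg := by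
        rw [div_pow, Real.sq_sqrt (Real.sqrt_pos.1 hs).le]; ring
  have hLarg : (nin : ℝ) * nout * b = (nin : ℝ) ^ 2 / 4 := by rw [hb, hnn]; ring
  have hrank := card_gaussian_eigenvalues_le hd hη hx hbig hK hKdef
  rw [hLarg]
  set M := max ((2 * Real.exp 1 / (d : ℝ) * Real.log ((nin : ℝ) ^ 2 / 4)) ^ d)
    ((4 * R ^ 2 * η * Real.exp 1 ^ 3 / (d : ℝ)) ^ d)
  set z := fun ω => eigenCoords hK c (w ω)
  have hzm : Measurable z := (measurable_eigenCoords hK c).comp hmeasw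
  have hlog : 0 ≤ Real.log (1 / δ') :=
    Real.log_nonneg (by rw [le_div_iff₀ hδ'.1]; linarith [hδ'.2])
  have htail := subGaussian_norm_sq_tail (volume.restrict E) hzm hν (by
    intro g
    obtain ⟨u, hu, huw⟩ := exists_dual_eigenCoords hK hc g
    rw [← hu]
    refine le_trans (le_of_eq ?_) (ENNReal.ofReal_le_ofReal (hsubg u))
    have hfin : (Set.range fun ω => Real.exp (u ⬝ᵥ (K *ᵥ w ω))).Finite := by
      refine (Set.finite_range fun S : Finset (Fin nin) =>
        Real.exp (u ⬝ᵥ (K *ᵥ (probVec univ - probVec S)))).subset ?_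
      rintro _ ⟨ω, rfl⟩
      exact ⟨Sout ω, by simp only [hw]⟩
    obtain ⟨C, hC⟩ := hfin.isBounded.exists_norm_le
    have hmeas : Measurable fun ω => Real.exp (u ⬝ᵥ (K *ᵥ w ω)) := by
      simp_rw [huw]
      exact (hzm.const_inner (c := g)).exp
    rw [ofReal_integral_eq_lintegral_ofReal
      (Integrable.of_bound hmeas.aestronglyMeasurable C
        (.of_forall fun ω => hC _ ⟨ω, rfl⟩)) (.of_forall fun ω => (Real.exp_pos _).le)]
    simp_rw [huw]
    rfl) hδ'.1
  set B := {ω | ν ^ 2 * (Real.exp 1 ^ 2 * Fintype.card {i // c < hK.eigenvalues i} +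
    Real.exp 1 * Real.log (1 / δ')) ≤ ‖z ω‖ ^ 2}
  have hBm : MeasurableSet B := measurableSet_le measurable_const (hzm.norm.pow_const 2)
  rw [Measure.restrict_apply hBm] at htail
  have htail' : (volume (B ∩ E)).toReal ≤ δ' :=
    ENNReal.toReal_le_of_le_ofReal hδ'.1.le htail
  have hdiff : (volume E).toReal - (volume (B ∩ E)).toReal = (volume (E \ B)).toReal := by
    have := measureReal_inter_add_sdiff (μ := (volume : Measure Ω)) (s := E) hBm
    rw [Set.inter_comm] at this
    simp only [Measure.real] at this
    linarith
  refine le_trans (b := (volume (E \ B)).toReal) (by linarith)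
    (ENNReal.toReal_mono (measure_ne_top _ _) (measure_mono ?_))
  rintro ω ⟨-, hω⟩
  have hω' : ‖z ω‖ ^ 2 < ν ^ 2 * (Real.exp 1 ^ 2 * Fintype.card {i // c < hK.eigenvalues i} +
    Real.exp 1 * Real.log (1 / δ')) := not_le.1 hω
  have hww : w ω ⬝ᵥ w ω = 1 / (nout : ℝ) - 1 / nin := by
    rw [hw, probVec_sub_dotProduct_self (by rw [hcard]; exact_mod_cast hout), hcard]
  have hcb : c = 1 / (nout * b) := by
    rw [hcdef, hb, hnn]; field_simp; norm_num
  have hform := dotProduct_mulVec_le hK hc (w ω)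
  rw [← norm_eigenCoords_sq hK hc, hww] at hform
  rw [← hcb]
  refine hform.trans (add_le_add_left ?_ _)
  have hlg := (sq_nonneg ν).trans hνsq
  refine hω'.le.trans ?_
  gcongr

end
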